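/- arXiv:2512.24105 — 3 statements merged into one kernel-verified Lean document; each statement's English description precedes it below -/
import Mathlib

section
/- The estimated utility v̂ has binary marginal gains: for every subset S ⊆ G and every item g ∈ G \ S, one has v̂(S) ≤ v̂(S ∪ {g}) ≤ v̂(S) + 1. -/
open scoped Classical

/-- A set function `u` on subsets of the finite ground set `I` (the set of items `G`)
is a *matroid rank function* (MRF): it vanishes on `∅`, is monotone, is submodular,
and has binary marginal gains. -/
def IsMRF {I : Type*} [DecidableEq I] (u : Finset I → ℕ) : Prop :=
  u ∅ = 0 ∧
  (∀ S T : Finset I, S ⊆ T → u S ≤ u T) ∧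
  (∀ S T : Finset I, S ⊆ T → ∀ g ∉ T, u (T ∪ {g}) + u S ≤ u (S ∪ {g}) + u T) ∧
  ∀ (S : Finset I) (g : I), g ∉ S → u S ≤ u (S ∪ {g}) ∧ u (S ∪ {g}) ≤ u S + 1

/-- A *local allocation* of the bundle `S` to the agents in `L`: a family of pairwise
disjoint subsets of `S`. -/
def IsLocalAlloc {I L : Type*} [DecidableEq I] (S : Finset I) (A : L → Finset I) : Prop :=
  (∀ x, A x ⊆ S) ∧ ∀ x y : L, x ≠ y → Disjoint (A x) (A y)

/-- The *estimated utility* `v̂(S)`: the maximum, over local allocations `A` of `S`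
to the agents in `L`, of `∑ x, u x (A x)`. -/
noncomputable def vhat {I L : Type*} [Fintype I] [DecidableEq I] [Fintype L] [DecidableEq L]
    (u : L → Finset I → ℕ) (S : Finset I) : ℕ :=
  (Finset.univ.filter fun A : L → Finset I => IsLocalAlloc S A).sup
    fun A => ∑ x, u x (A x)

section Allocations

variable {I L : Type*} [DecidableEq I]

theorem IsLocalAlloc.mono {S T : Finset I} {A : L → Finset I} (hA : IsLocalAlloc S A)
    (hST : S ⊆ T) : IsLocalAlloc T A :=
  ⟨fun x => (hA.1 x).trans hST, hA.2⟩

theorem IsLocalAlloc.erase {S : Finset I} {A : L → Finset I} (hA : IsLocalAlloc S A) (g : I) :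
    IsLocalAlloc (S.erase g) fun x => (A x).erase g :=
  ⟨fun x => Finset.erase_subset_erase g (hA.1 x), fun x y hxy =>
    (hA.2 x y hxy).mono (Finset.erase_subset _ _) (Finset.erase_subset _ _)⟩

theorem IsMRF.le_erase_add {u : Finset I → ℕ} (hu : IsMRF u) (T : Finset I) (g : I) :
    u T ≤ u (T.erase g) + if g ∈ T then 1 else 0 := by
  by_cases hg : g ∈ T
  · have h := (hu.2.2.2 (T.erase g) g (Finset.notMem_erase g T)).2
    rw [Finset.union_comm, ← Finset.insert_eq, Finset.insert_erase hg] at h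
    simpa [hg] using h
  · simp [hg]

variable [Fintype L]

/-- At most one agent receives a given item. -/
theorem IsLocalAlloc.sum_mem_le_one {S : Finset I} {A : L → Finset I} (hA : IsLocalAlloc S A)
    (g : I) : (∑ x, if g ∈ A x then 1 else 0) ≤ 1 := by
  rw [Finset.sum_boole, Nat.cast_id, Finset.card_le_one]
  intro x hx y hy
  by_contra hxy
  exact Finset.disjoint_left.1 (hA.2 x y hxy) (Finset.mem_filter.1 hx).2
    (Finset.mem_filter.1 hy).2

variable [Fintype I] [DecidableEq L]

theorem IsLocalAlloc.sum_le_vhat {S : Finset I} {A : L → Finset I} (hA : IsLocalAlloc S A)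
    (u : L → Finset I → ℕ) : ∑ x, u x (A x) ≤ vhat u S :=
  Finset.le_sup (f := fun A : L → Finset I => ∑ x, u x (A x)) (by simpa using hA)

theorem vhat_le_iff {u : L → Finset I → ℕ} {S : Finset I} {n : ℕ} :
    vhat u S ≤ n ↔ ∀ A : L → Finset I, IsLocalAlloc S A → ∑ x, u x (A x) ≤ n := by
  simp [vhat, Finset.sup_le_iff]

end Allocations

/-- the estimated utility `v̂` has binary marginal gains:
for every `S ⊆ G` and every `g ∈ G \ S`, `v̂(S) ≤ v̂(S ∪ {g}) ≤ v̂(S) + 1`. -/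
theorem vhat_binary_marginal_gains {I L : Type*} [Fintype I] [DecidableEq I]
    [Fintype L] [DecidableEq L] [Nonempty L]
    (u : L → Finset I → ℕ) (hu : ∀ x, IsMRF (u x)) :
    ∀ (S : Finset I) (g : I), g ∉ S →
      vhat u S ≤ vhat u (S ∪ {g}) ∧ vhat u (S ∪ {g}) ≤ vhat u S + 1 := by
  intro S g hg
  refine ⟨vhat_le_iff.2 fun A hA => (hA.mono Finset.subset_union_left).sum_le_vhat u,
    vhat_le_iff.2 fun A hA => ?_⟩
  have hB := hA.erase g
  rw [Finset.union_comm, ← Finset.insert_eq, Finset.erase_insert hg] at hB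
  calc ∑ x, u x (A x)
      ≤ ∑ x, (u x ((A x).erase g) + if g ∈ A x then 1 else 0) :=
        Finset.sum_le_sum fun x _ => (hu x).le_erase_add (A x) g
    _ = ∑ x, u x ((A x).erase g) + ∑ x, (if g ∈ A x then 1 else 0) := Finset.sum_add_distrib
    _ ≤ vhat u S + 1 := add_le_add (hB.sum_le_vhat u) (hA.sum_mem_le_one g)
end

section
/- The estimated utility v̂ is itself a matroid rank function: v̂(∅) = 0, v̂ is monotone, v̂ is submodular, and v̂ has binary marginal gains. -/
open scoped Classical

namespace IsMRF

variable {I : Type*} [DecidableEq I] {u : Finset I → ℕ}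

theorem le_insert_add_one (hu : IsMRF u) (S : Finset I) (g : I) : u (insert g S) ≤ u S + 1 := by
  by_cases hg : g ∈ S
  · simp [hg]
  · have h := (hu.2.2.2 S g hg).2
    rwa [Finset.union_singleton] at h

theorem le_add_card_sdiff (hu : IsMRF u) (S T : Finset I) : u T ≤ u S + (T \ S).card := by
  have key : ∀ C : Finset I, u (S ∪ C) ≤ u S + C.card := by
    intro C
    induction C using Finset.induction_on with
    | empty => simp
    | insert a C ha ih =>
      rw [Finset.union_insert, Finset.card_insert_of_notMem ha]
      have := hu.le_insert_add_one (S ∪ C) a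
      omega
  refine (hu.2.1 _ _ ?_).trans (key (T \ S))
  simp

theorem le_card (hu : IsMRF u) (S : Finset I) : u S ≤ S.card := by
  simpa [hu.1] using hu.le_add_card_sdiff ∅ S

theorem eq_card_of_subset (hu : IsMRF u) {S T : Finset I} (hST : S ⊆ T) (hT : u T = T.card) :
    u S = S.card := by
  have h₁ := hu.le_add_card_sdiff S T
  have h₂ := hu.le_card S
  have h₃ := Finset.card_sdiff_add_card_eq_card hST
  omega

theorem union_le_of_forall_insert_le (hu : IsMRF u) {S C : Finset I}
    (h : ∀ e ∈ C, u (insert e S) ≤ u S) : u (S ∪ C) ≤ u S := by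
  induction C using Finset.induction_on with
  | empty => simp
  | insert a C ha ih =>
    have ih := ih fun e he => h e (Finset.mem_insert_of_mem he)
    have haS := h a (Finset.mem_insert_self a C)
    rw [Finset.union_insert]
    by_cases hmem : a ∈ S ∪ C
    · rwa [Finset.insert_eq_of_mem hmem]
    · have hsub := hu.2.2.1 S (S ∪ C) Finset.subset_union_left a hmem
      rw [Finset.union_singleton, Finset.union_singleton] at hsub
      omega

/-- Every set contains an independent set of full rank. -/
theorem exists_subset_eq_card (hu : IsMRF u) (S : Finset I) :
    ∃ T ⊆ S, u T = T.card ∧ T.card = u S := by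
  induction S using Finset.induction_on with
  | empty => exact ⟨∅, subset_rfl, by simp [hu.1]⟩
  | insert a S ha ih =>
    obtain ⟨T, hTS, hT, hcard⟩ := ih
    have h₁ := hu.le_insert_add_one S a
    have h₂ := hu.2.1 _ _ (Finset.subset_insert a S)
    by_cases h : u (insert a S) = u S
    · exact ⟨T, hTS.trans (Finset.subset_insert a S), hT, by omega⟩
    · have haT : a ∉ T := fun h => ha (hTS h)
      have hsub := hu.2.2.1 T S hTS a ha
      rw [Finset.union_singleton, Finset.union_singleton] at hsub
      have h₃ := hu.le_card (insert a T)
      have h₄ := Finset.card_insert_of_notMem haT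
      exact ⟨insert a T, Finset.insert_subset_insert a hTS, by omega, by omega⟩

/-- The augmentation property of the independent sets of a matroid rank function. -/
theorem exists_insert_eq_card (hu : IsMRF u) {S T : Finset I} (hS : u S = S.card)
    (hT : u T = T.card) (hlt : S.card < T.card) :
    ∃ e ∈ T, e ∉ S ∧ u (insert e S) = (insert e S).card := by
  by_contra! hcon
  have h : ∀ e ∈ T, u (insert e S) ≤ u S := by
    intro e he
    by_cases heS : e ∈ S
    · simp [heS]
    · have h₁ := hcon e he heS
      have h₂ := hu.le_insert_add_one S e
      rw [Finset.card_insert_of_notMem heS] at h₁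
      omega
  have h₁ := hu.union_le_of_forall_insert_le h
  have h₂ := hu.2.1 T (S ∪ T) Finset.subset_union_right
  omega

end IsMRF

section Union

variable {I L : Type*} [DecidableEq I] [Fintype L] {u : L → Finset I → ℕ}

/-- `X` is independent in the union of the matroids with rank functions `u x`: it splits into
pairwise disjoint parts, the part of `x` being independent for `u x`. -/
def UnionIndep (u : L → Finset I → ℕ) (X : Finset I) : Prop :=
  ∃ A : L → Finset I, (∀ x y, x ≠ y → Disjoint (A x) (A y)) ∧
    (∀ x, u x (A x) = (A x).card) ∧ Finset.univ.biUnion A = X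

theorem UnionIndep.subset (hu : ∀ x, IsMRF (u x)) {X Y : Finset I} (hX : UnionIndep u X)
    (hYX : Y ⊆ X) : UnionIndep u Y := by
  obtain ⟨A, hA, hind, rfl⟩ := hX
  refine ⟨fun x => A x ∩ Y, fun x y hxy => (hA x y hxy).mono Finset.inter_subset_left
    Finset.inter_subset_left, fun x => (hu x).eq_card_of_subset Finset.inter_subset_left (hind x),
    ?_⟩
  rw [← Finset.biUnion_inter, Finset.inter_eq_right.2 hYX]

theorem UnionIndep.exists_insert (hu : ∀ x, IsMRF (u x)) {X Y : Finset I} (hX : UnionIndep u X)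
    (hY : UnionIndep u Y) (hlt : X.card < Y.card) :
    ∃ e ∈ Y, e ∉ X ∧ UnionIndep u (insert e X) := by
  obtain ⟨B, hB, hBind, rfl⟩ := hY
  obtain ⟨A, hA, hAind, hAX⟩ := hX
  induction hn : ∑ x, (B x \ A x).card using Nat.strong_induction_on generalizing A with
  | _ n ih =>
    have hsum : ∑ x, (A x).card < ∑ x, (B x).card := by
      rwa [← Finset.card_biUnion fun x _ y _ => hA x y,
        ← Finset.card_biUnion fun x _ y _ => hB x y, hAX]
    obtain ⟨x, -, hx⟩ := Finset.exists_lt_of_sum_lt hsum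
    obtain ⟨e, heB, heA, he⟩ := (hu x).exists_insert_eq_card (hAind x) (hBind x) hx
    let A' : L → Finset I := fun z => if z = x then insert e (A x) else (A z).erase e
    have hA'x : A' x = insert e (A x) := if_pos rfl
    have hA'z : ∀ z, z ≠ x → A' z = (A z).erase e := fun z hz => if_neg hz
    have hA' : ∀ y z, y ≠ z → Disjoint (A' y) (A' z) := by
      intro y z hyz
      have hd := hA y z hyz
      rw [Finset.disjoint_left] at hd ⊢
      intro a hay haz
      by_cases hy : y = x
      · subst hy
        rw [hA'x] at hay
        rw [hA'z z hyz.symm] at haz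
        grind
      · rw [hA'z y hy] at hay
        by_cases hz : z = x
        · subst hz
          rw [hA'x] at haz
          grind
        · rw [hA'z z hz] at haz
          grind
    have hA'ind : ∀ z, u z (A' z) = (A' z).card := by
      intro z
      by_cases hz : z = x
      · subst hz
        rw [hA'x, he]
      · rw [hA'z z hz]
        exact (hu z).eq_card_of_subset (Finset.erase_subset _ _) (hAind z)
    have hA'X : Finset.univ.biUnion A' = insert e X := by
      ext a
      simp only [← hAX, Finset.mem_biUnion, Finset.mem_univ, true_and, Finset.mem_insert]
      constructor
      · rintro ⟨z, hz⟩
        by_cases hzx : z = x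
        · subst hzx
          rw [hA'x] at hz
          grind
        · rw [hA'z z hzx] at hz
          grind
      · by_cases hae : a = e
        · exact fun _ => ⟨x, by simp [hA'x, hae]⟩
        · rintro (h | ⟨z, hz⟩)
          · exact absurd h hae
          · by_cases hzx : z = x
            · subst hzx
              exact ⟨z, by simp [hA'x, hz]⟩
            · exact ⟨z, by simp [hA'z z hzx, hz, hae]⟩
    by_cases heX : e ∈ X
    · refine ih _ ?_ A' hA' hA'ind (by rw [hA'X, Finset.insert_eq_of_mem heX]) rfl
      rw [← hn]
      refine Finset.sum_lt_sum (fun z _ => Finset.card_le_card ?_)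
        ⟨x, Finset.mem_univ x, Finset.card_lt_card ?_⟩
      · by_cases hz : z = x
        · subst hz
          rw [hA'x]
          exact Finset.sdiff_subset_sdiff subset_rfl (Finset.subset_insert _ _)
        · rw [hA'z z hz]
          have := Finset.disjoint_left.1 (hB x z (Ne.symm hz)) heB
          grind
      · rw [hA'x, Finset.ssubset_iff_of_subset
          (Finset.sdiff_subset_sdiff subset_rfl (Finset.subset_insert _ _))]
        exact ⟨e, by simp [heB, heA], by simp⟩
    · exact ⟨e, Finset.mem_biUnion.2 ⟨x, Finset.mem_univ x, heB⟩, heX, A', hA', hA'ind, hA'X⟩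

variable [Fintype I] [DecidableEq L]

theorem UnionIndep.card_le_vhat {X S : Finset I} (hX : UnionIndep u X) (hXS : X ⊆ S) :
    X.card ≤ vhat u S := by
  obtain ⟨A, hA, hind, rfl⟩ := hX
  have hmem : A ∈ Finset.univ.filter fun A : L → Finset I => IsLocalAlloc S A := by
    simp only [Finset.mem_filter, Finset.mem_univ, true_and]
    exact ⟨fun x => (Finset.subset_biUnion_of_mem A (Finset.mem_univ x)).trans hXS, hA⟩
  rw [Finset.card_biUnion fun x _ y _ => hA x y, ← Finset.sum_congr rfl fun x _ => hind x]
  exact Finset.le_sup (f := fun A : L → Finset I => ∑ x, u x (A x)) hmem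

theorem exists_unionIndep_card_eq_vhat (hu : ∀ x, IsMRF (u x)) (S : Finset I) :
    ∃ X ⊆ S, UnionIndep u X ∧ X.card = vhat u S := by
  have hne : (Finset.univ.filter fun A : L → Finset I => IsLocalAlloc S A).Nonempty :=
    ⟨fun _ => ∅, Finset.mem_filter.2 ⟨Finset.mem_univ _, fun _ => Finset.empty_subset S,
      fun _ _ _ => Finset.disjoint_empty_left _⟩⟩
  obtain ⟨A, hA, hmax⟩ := Finset.exists_mem_eq_sup _ hne fun A => ∑ x, u x (A x)
  obtain ⟨hAS, hdisj⟩ := (Finset.mem_filter.1 hA).2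
  choose T hTA hT hcard using fun x => (hu x).exists_subset_eq_card (A x)
  have hdisjT : ∀ x y, x ≠ y → Disjoint (T x) (T y) :=
    fun x y hxy => (hdisj x y hxy).mono (hTA x) (hTA y)
  refine ⟨Finset.univ.biUnion T, Finset.biUnion_subset.2 fun x _ => (hTA x).trans (hAS x),
    ⟨T, hdisjT, hT, rfl⟩, ?_⟩
  rw [Finset.card_biUnion fun x _ y _ => hdisjT x y, vhat, hmax]
  exact Finset.sum_congr rfl fun x _ => hcard x

theorem vhat_mono (hu : ∀ x, IsMRF (u x)) {S T : Finset I} (hST : S ⊆ T) :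
    vhat u S ≤ vhat u T := by
  obtain ⟨X, hXS, hX, hcard⟩ := exists_unionIndep_card_eq_vhat hu S
  exact hcard ▸ hX.card_le_vhat (hXS.trans hST)

theorem vhat_insert_le (hu : ∀ x, IsMRF (u x)) (S : Finset I) (g : I) :
    vhat u (insert g S) ≤ vhat u S + 1 := by
  obtain ⟨X, hXS, hX, hcard⟩ := exists_unionIndep_card_eq_vhat hu (insert g S)
  have h₁ := (hX.subset hu (X.erase_subset g)).card_le_vhat (Finset.subset_insert_iff.1 hXS)
  have h₂ := Finset.pred_card_le_card_erase (s := X) (a := g)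
  omega

theorem vhat_insert_insert_le (hu : ∀ x, IsMRF (u x)) {S : Finset I} {g : I} (h : I)
    (hg : vhat u (insert g S) ≤ vhat u S) :
    vhat u (insert g (insert h S)) ≤ vhat u (insert h S) := by
  by_contra! hlt
  obtain ⟨X, hXS, hX, hXcard⟩ := exists_unionIndep_card_eq_vhat hu S
  obtain ⟨Y, hYS, hY, hYcard⟩ := exists_unionIndep_card_eq_vhat hu (insert g (insert h S))
  have hSh := vhat_mono hu (Finset.subset_insert h S)
  have hle := vhat_insert_le hu (insert g S) h
  rw [Finset.insert_comm] at hle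
  obtain ⟨e, heY, heX, he⟩ := hX.exists_insert hu hY (by omega)
  have hcard := Finset.card_insert_of_notMem heX
  obtain rfl | heS := Finset.mem_insert.1 (hYS heY)
  · have := he.card_le_vhat (Finset.insert_subset_insert e hXS)
    omega
  · have := he.card_le_vhat
      (Finset.insert_subset heS (hXS.trans (Finset.subset_insert h S)))
    omega

theorem vhat_insert_le_of_subset (hu : ∀ x, IsMRF (u x)) {S T : Finset I} {g : I} (hST : S ⊆ T)
    (hg : vhat u (insert g S) ≤ vhat u S) : vhat u (insert g T) ≤ vhat u T := by
  rw [← Finset.union_sdiff_of_subset hST]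
  induction T \ S using Finset.induction_on with
  | empty => simpa using hg
  | insert h C _ ih =>
    rw [Finset.union_insert]
    exact vhat_insert_insert_le hu h ih

end Union

/-- the estimated utility `v̂` is itself a matroid rank function:
`v̂(∅) = 0`, `v̂` is monotone, `v̂` is submodular, and `v̂` has binary marginal gains. -/
theorem vhat_isMRF {I L : Type*} [Fintype I] [DecidableEq I]
    [Fintype L] [DecidableEq L] [Nonempty L]
    (u : L → Finset I → ℕ) (hu : ∀ x, IsMRF (u x)) :
    IsMRF (vhat u) := by
  refine ⟨?_, fun S T => vhat_mono hu, fun S T hST g _ => ?_, fun S g _ => ?_⟩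
  · obtain ⟨X, hX, -, hcard⟩ := exists_unionIndep_card_eq_vhat hu ∅
    rw [← hcard, Finset.subset_empty.1 hX, Finset.card_empty]
  · rw [Finset.union_singleton, Finset.union_singleton]
    have h₁ := vhat_mono hu (Finset.subset_insert g S)
    have h₂ := vhat_insert_le hu T g
    by_cases hg : vhat u (insert g S) ≤ vhat u S
    · have := vhat_insert_le_of_subset hu hST hg
      omega
    · omega
  · rw [Finset.union_singleton]
    exact ⟨vhat_mono hu (Finset.subset_insert g S), vhat_insert_le hu S g⟩
end

section
/- Welfare effect of path augmentation: let π be a non-redundant allocation whose bundles partition G, let x, y ∈ L be distinct agents, let T = (g_1, …, g_t) be a shortest path in the exchange graph G(π) from F_x(π) to π(y), and let π' be the allocation obtained from π by the path augmentation along T (g_1 reassigned to x, each g_k for k ≥ 2 reassigned to the owner of g_{k−1} under π, all other items keeping their owner). Then the total utilitarian welfare is preserved, Σ_{z∈L} u_z(π'(z)) = Σ_{z∈L} u_z(π(z)), while the welfare of the agents other than y strictly increases by one: Σ_{z∈L, z≠y} u_z(π'(z)) = Σ_{z∈L, z≠y} u_z(π(z)) + 1. -/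
open scoped Classical

/-- There is an arc from `g` to `g'` in the exchange graph `G(π)`: the owner `x` of `g`
differs from the owner `y` of `g'`, and `x` is indifferent between `g` and `g'` given
its bundle, i.e. `u x ((π x \ {g}) ∪ {g'}) = u x (π x)`. -/
def ExchangeArc {I L : Type*} [DecidableEq I] (u : L → Finset I → ℕ)
    (π : L → Finset I) (g g' : I) : Prop :=
  ∃ x y : L, x ≠ y ∧ g ∈ π x ∧ g' ∈ π y ∧ u x ((π x \ {g}) ∪ {g'}) = u x (π x)

/-- `F_x(π)`: the set of items for which agent `x` has a strictly positive marginal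
gain given its bundle `π x`. -/
def Fgain {I L : Type*} [DecidableEq I] (u : L → Finset I → ℕ)
    (π : L → Finset I) (x : L) : Set I :=
  {g | u x (π x ∪ {g}) = u x (π x) + 1}

/-- A *transfer path* in the exchange graph `G(π)` from `F_x(π)` to `π(y)`:
a sequence of items `gs 0, …, gs (t-1)` (`t ≥ 1`) with `gs 0 ∈ F_x(π)`,
`gs (t-1) ∈ π y`, and consecutive items joined by arcs of `G(π)`. -/
def IsTransferPath {I L : Type*} [DecidableEq I] (u : L → Finset I → ℕ)
    (π : L → Finset I) (x y : L) (t : ℕ) (gs : ℕ → I) : Prop :=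
  1 ≤ t ∧ gs 0 ∈ Fgain u π x ∧ gs (t - 1) ∈ π y ∧
    ∀ k : ℕ, k + 1 < t → ExchangeArc u π (gs k) (gs (k + 1))

namespace IsMRF

variable {I : Type*} [DecidableEq I] {v : Finset I → ℕ}

theorem union_add_inter_le (hv : IsMRF v) (P Q : Finset I) :
    v (P ∪ Q) + v (P ∩ Q) ≤ v P + v Q := by
  suffices h : ∀ R : Finset I, ∀ A B : Finset I, A ⊆ B → Disjoint B R →
      v (B ∪ R) + v A ≤ v (A ∪ R) + v B by
    have h1 := h (Q \ P) (P ∩ Q) P Finset.inter_subset_left Finset.disjoint_sdiff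
    have e1 : P ∪ Q \ P = P ∪ Q := by ext; simp
    have e2 : P ∩ Q ∪ Q \ P = Q := by ext; grind
    rw [e1, e2] at h1
    omega
  intro R
  induction R using Finset.induction_on with
  | empty => intro A B _ _; simp [add_comm]
  | insert g R hg ih =>
    intro A B hAB hd
    rw [Finset.disjoint_insert_right] at hd
    have h1 := ih A B hAB hd.2
    have h2 := hv.2.2.1 (A ∪ R) (B ∪ R) (Finset.union_subset_union_left hAB) g
      (by simp [hg, hd.1])
    have e : ∀ C : Finset I, C ∪ insert g R = C ∪ R ∪ {g} := by intro C; ext; grind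
    rw [e, e]
    omega

theorem le_add_card (hv : IsMRF v) (A R : Finset I) : v (A ∪ R) ≤ v A + R.card := by
  induction R using Finset.induction_on with
  | empty => simp
  | insert g R hg ih =>
    rw [Finset.card_insert_of_notMem hg]
    have e : A ∪ insert g R = A ∪ R ∪ {g} := by ext; grind
    rw [e]
    by_cases hgA : g ∈ A ∪ R
    · rw [Finset.union_eq_left.2 (Finset.singleton_subset_iff.2 hgA)]; omega
    · have := (hv.2.2.2 (A ∪ R) g hgA).2; omega

theorem le_card_s10 (hv : IsMRF v) (A : Finset I) : v A ≤ A.card := by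
  simpa [hv.1] using hv.le_add_card ∅ A

theorem eq_card_of_subset_s10 (hv : IsMRF v) {A B : Finset I} (hAB : A ⊆ B)
    (hB : v B = B.card) : v A = A.card := by
  have h1 := hv.le_add_card A (B \ A)
  rw [Finset.union_sdiff_of_subset hAB] at h1
  have := Finset.card_sdiff_add_card_eq_card hAB
  have := hv.le_card_s10 A
  omega

/-- Inside an independent set, an element spanned by two subsets is spanned by their
intersection. -/
theorem inter_union_singleton_le_card (hv : IsMRF v) {T P Q : Finset I} {b : I}
    (hT : v T = T.card) (hPT : P ⊆ T) (hQT : Q ⊆ T) (hP : v (P ∪ {b}) ≤ P.card)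
    (hQ : v (Q ∪ {b}) ≤ Q.card) : v (P ∩ Q ∪ {b}) ≤ (P ∩ Q).card := by
  have h1 := hv.union_add_inter_le (P ∪ {b}) (Q ∪ {b})
  have h2 := hv.2.1 (P ∪ Q) (P ∪ {b} ∪ (Q ∪ {b})) (by grind)
  rw [← Finset.inter_union_distrib_right] at h1
  have h3 := hv.eq_card_of_subset_s10 (Finset.union_subset hPT hQT) hT
  have := Finset.card_union_add_card_inter P Q
  omega

/-- An element spanned by an independent set, and still spanned after the deletion of any
single element of `D`, is spanned after the deletion of all of `D`. -/
theorem sdiff_union_singleton_le_card (hv : IsMRF v) {S D : Finset I} {b : I}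
    (hS : v S = S.card) (hb : v (S ∪ {b}) ≤ S.card)
    (hD : ∀ d ∈ D, d ∈ S → v (S \ {d} ∪ {b}) < S.card) :
    v (S \ D ∪ {b}) ≤ (S \ D).card := by
  induction D using Finset.induction_on with
  | empty => simpa using hb
  | insert d D _ ih =>
    have ih := ih fun e he => hD e (Finset.mem_insert_of_mem he)
    by_cases hd : d ∈ S
    · have h1 := hD d (Finset.mem_insert_self _ _) hd
      have hc : (S \ {d}).card + 1 = S.card := by
        rw [Finset.sdiff_singleton_eq_erase]; exact Finset.card_erase_add_one hd
      have h2 := hv.inter_union_singleton_le_card hS Finset.sdiff_subset Finset.sdiff_subset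
        (show v (S \ {d} ∪ {b}) ≤ (S \ {d}).card by omega) ih
      have e : S \ {d} ∩ (S \ D) = S \ insert d D := by ext; simp; tauto
      rwa [e] at h2
    · have e : S \ insert d D = S \ D := by ext; simp; grind
      rwa [e]

/-- If `b` can replace `a` in the independent set `S` and is spanned by `S \ D`, then `b` can
replace `a` in every independent set `T` containing `S \ D`. -/
theorem exchange_of_span_sdiff (hv : IsMRF v) {S D T : Finset I} {a b : I}
    (hS : v S = S.card) (ha : a ∈ S) (hb : b ∉ S) (hab : v (S \ {a} ∪ {b}) = v S)
    (hspan : v (S \ D ∪ {b}) ≤ (S \ D).card) (hT : v T = T.card) (hDT : S \ D ⊆ T)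
    (haT : a ∈ T) :
    v (T \ {a} ∪ {b}) = (T \ {a} ∪ {b}).card ∧ (T \ {a} ∪ {b}).card = T.card := by
  have hcT : (T \ {a}).card + 1 = T.card := by
    rw [Finset.sdiff_singleton_eq_erase]; exact Finset.card_erase_add_one haT
  have hcS : (S \ {a}).card + 1 = S.card := by
    rw [Finset.sdiff_singleton_eq_erase]; exact Finset.card_erase_add_one ha
  have key : (T \ {a}).card < v (T \ {a} ∪ {b}) := by
    by_contra! h
    have h2 := hv.inter_union_singleton_le_card hT Finset.sdiff_subset hDT h hspan
    have hbS : (S \ {a} ∪ {b}).card = (S \ {a}).card + 1 := by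
      rw [Finset.card_union_of_disjoint (by simp [hb])]; simp
    have h3 := hv.eq_card_of_subset_s10 (A := T \ {a} ∩ (S \ D) ∪ {b}) (B := S \ {a} ∪ {b})
      (by grind) (by omega)
    rw [Finset.card_union_of_disjoint (by simp [hb])] at h3
    simp only [Finset.card_singleton] at h3
    omega
  have h1 := hv.le_card_s10 (T \ {a} ∪ {b})
  have h2 := Finset.card_union_le (T \ {a}) {b}
  simp only [Finset.card_singleton] at h2
  omega

end IsMRF

section ShortestPath

variable {I L : Type*} [DecidableEq I] {u : L → Finset I → ℕ} {π : L → Finset I} {x y : L}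
  {t : ℕ} {gs : ℕ → I}

/-- A transfer path of minimum length. -/
def IsShortestTransferPath (u : L → Finset I → ℕ) (π : L → Finset I) (x y : L) (t : ℕ)
    (gs : ℕ → I) : Prop :=
  IsTransferPath u π x y t gs ∧
    ∀ (t' : ℕ) (gs' : ℕ → I), IsTransferPath u π x y t' gs' → t ≤ t'

namespace IsShortestTransferPath

theorem not_exchangeArc (h : IsShortestTransferPath u π x y t gs) {i k : ℕ} (hik : i < k)
    (hk : k + 1 < t) : ¬ ExchangeArc u π (gs i) (gs (k + 1)) := by
  intro harc
  obtain ⟨⟨h1, h2, h3, h4⟩, hmin⟩ := h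
  have := hmin (t - (k - i)) (fun n => if n ≤ i then gs n else gs (n + (k - i))) ?_
  · omega
  refine ⟨by omega, by simpa using h2, ?_, ?_⟩
  · beta_reduce
    rw [if_neg (by omega)]
    convert h3 using 2
    omega
  · intro m hm
    beta_reduce
    rcases lt_trichotomy m i with hmi | hmi | hmi
    · rw [if_pos (by omega), if_pos (by omega)]
      exact h4 m (by omega)
    · subst hmi
      rw [if_pos le_rfl, if_neg (by omega)]
      convert harc using 2
      omega
    · rw [if_neg (by omega), if_neg (by omega)]
      have := h4 (m + (k - i)) (by omega)
      convert this using 2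
      omega

theorem notMem_Fgain (h : IsShortestTransferPath u π x y t gs) {j : ℕ} (hj : 0 < j)
    (hjt : j < t) : gs j ∉ Fgain u π x := by
  intro hF
  obtain ⟨⟨h1, h2, h3, h4⟩, hmin⟩ := h
  have := hmin (t - j) (fun n => gs (n + j)) ?_
  · omega
  refine ⟨by omega, by simpa using hF, ?_, ?_⟩
  · convert h3 using 2
    omega
  · intro m hm
    have := h4 (m + j) (by omega)
    convert this using 2
    omega

theorem notMem_target (h : IsShortestTransferPath u π x y t gs) {j : ℕ} (hj : j + 1 < t) :
    gs j ∉ π y := by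
  intro hy
  obtain ⟨⟨h1, h2, h3, h4⟩, hmin⟩ := h
  have := hmin (j + 1) gs ⟨by omega, h2, by simpa using hy, fun m hm => h4 m (by omega)⟩
  omega

theorem ne_of_lt (h : IsShortestTransferPath u π x y t gs) {i j : ℕ} (hij : i < j)
    (hj : j < t) : gs i ≠ gs j := by
  intro e
  rcases Nat.eq_zero_or_pos i with rfl | hi
  · exact h.notMem_Fgain hij hj (e ▸ h.1.2.1)
  · obtain ⟨m, rfl⟩ : ∃ m, i = m + 1 := ⟨i - 1, by omega⟩
    obtain ⟨k, rfl⟩ : ∃ k, j = k + 1 := ⟨j - 1, by omega⟩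
    exact h.not_exchangeArc (i := m) (k := k) (by omega) hj
      (e ▸ h.1.2.2.2 m (by omega))

end IsShortestTransferPath

/-- The agent receiving the item at position `k` of the path. -/
def pathRecipient (own : I → L) (x : L) (gs : ℕ → I) (k : ℕ) : L :=
  if k = 0 then x else own (gs (k - 1))

/-- The bundle of `z` once the first `k` items of the path have left their owners and the first
`k + 1` items have reached their recipients. -/
def partialBundle [DecidableEq L] (π : L → Finset I) (own : I → L) (x : L) (gs : ℕ → I) (z : L)
    (k : ℕ) : Finset I :=
  (π z \ (Finset.range k).image gs) ∪
    ((Finset.range (k + 1)).filter fun i => pathRecipient own x gs i = z).image gs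

theorem partialBundle_independent [DecidableEq L] (hu : ∀ z, IsMRF (u z)) {own : I → L}
    (hown : ∀ (i : I) (z : L), i ∈ π z ↔ own i = z) (hnr : ∀ z, u z (π z) = (π z).card)
    (h : IsShortestTransferPath u π x y t gs) (z : L) (k : ℕ) (hk : k < t) :
    u z (partialBundle π own x gs z k) = (partialBundle π own x gs z k).card ∧
      (partialBundle π own x gs z k).card = (π z).card + if z = x then 1 else 0 := by
  have harc : ∀ {g g' : I}, ExchangeArc u π g g' →
      own g ≠ own g' ∧ u (own g) (π (own g) \ {g} ∪ {g'}) = u (own g) (π (own g)) := by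
    rintro g g' ⟨a, b, hab, ha, hb, e⟩
    rw [hown] at ha hb
    subst ha hb
    exact ⟨hab, e⟩
  have hF : u x (π x ∪ {gs 0}) = u x (π x) + 1 := h.1.2.1
  have h0 : own (gs 0) ≠ x := by
    intro e
    rw [← hown] at e
    rw [Finset.union_eq_left.2 (Finset.singleton_subset_iff.2 e)] at hF
    omega
  induction k with
  | zero =>
    by_cases hz : z = x
    · subst hz
      have e : partialBundle π own z gs z 0 = π z ∪ {gs 0} := by
        simp [partialBundle, pathRecipient, Finset.filter_singleton]
      have hc : (π z ∪ {gs 0}).card = (π z).card + 1 := by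
        rw [Finset.card_union_of_disjoint (by simp [hown, h0])]; simp
      rw [e, hF, hc, hnr]
      simp
    · have e : partialBundle π own x gs z 0 = π z := by
        simp [partialBundle, pathRecipient, Finset.filter_singleton, Ne.symm hz]
      rw [e]
      simp [hnr, hz]
  | succ k ih =>
    have ih := ih (by omega)
    have hrec : pathRecipient own x gs (k + 1) = own (gs k) := by simp [pathRecipient]
    have hrange : ((Finset.range (k + 1 + 1)).filter fun i => pathRecipient own x gs i = z) =
        if own (gs k) = z then insert (k + 1) ((Finset.range (k + 1)).filter fun i =>
          pathRecipient own x gs i = z) else (Finset.range (k + 1)).filter fun i =>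
          pathRecipient own x gs i = z := by
      rw [Finset.range_add_one, Finset.filter_insert, hrec]
    by_cases hz : own (gs k) = z
    swap
    · have e : partialBundle π own x gs z (k + 1) = partialBundle π own x gs z k := by
        unfold partialBundle
        rw [hrange, if_neg hz]
        congr 1
        rw [Finset.range_add_one, Finset.image_insert]
        ext i
        have : gs k ∉ π z := by rwa [hown]
        grind
      rw [e]
      exact ih
    · obtain ⟨hne, hex⟩ := harc (h.1.2.2.2 k hk)
      rw [hz] at hne hex
      have hkS : gs k ∈ π z := by rwa [hown]
      have hbS : gs (k + 1) ∉ π z := by rw [hown]; exact hne.symm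
      have hknot : gs k ∉ ((Finset.range (k + 1)).filter fun i =>
          pathRecipient own x gs i = z).image gs := by
        simp only [Finset.mem_image, Finset.mem_filter, Finset.mem_range, not_exists, not_and]
        rintro i ⟨hi, hiz⟩ e
        rcases Nat.lt_succ_iff_lt_or_eq.1 hi with hi | rfl
        · exact h.ne_of_lt hi (by omega) e
        · rcases Nat.eq_zero_or_pos i with rfl | hi0
          · simp only [pathRecipient, if_true] at hiz
            exact h0 (hz.trans hiz.symm)
          · obtain ⟨m, rfl⟩ : ∃ m, i = m + 1 := ⟨i - 1, by omega⟩
            have := (harc (h.1.2.2.2 m (by omega))).1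
            simp only [pathRecipient, Nat.add_sub_cancel] at hiz
            rw [if_neg (by omega)] at hiz
            exact this (hiz.trans hz.symm)
      have hkimg : gs k ∉ (Finset.range k).image gs := by
        simp only [Finset.mem_image, Finset.mem_range, not_exists, not_and]
        exact fun i hi e => h.ne_of_lt hi (by omega) e
      have e : partialBundle π own x gs z (k + 1) =
          partialBundle π own x gs z k \ {gs k} ∪ {gs (k + 1)} := by
        unfold partialBundle
        rw [hrange, if_pos hz, Finset.image_insert, Finset.range_add_one (n := k),
          Finset.image_insert, ← Finset.range_add_one]
        generalize ((Finset.range (k + 1)).filter fun i =>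
          pathRecipient own x gs i = z).image gs = A at *
        generalize (Finset.range k).image gs = B at *
        ext i
        simp only [Finset.mem_union, Finset.mem_sdiff, Finset.mem_insert, Finset.mem_singleton]
        grind
      have hD : ∀ d ∈ (Finset.range k).image gs, d ∈ π z →
          u z (π z \ {d} ∪ {gs (k + 1)}) < (π z).card := by
        intro d hd hdz
        obtain ⟨i, hi, rfl⟩ := Finset.mem_image.1 hd
        have h1 : u z (π z \ {gs i} ∪ {gs (k + 1)}) ≠ u z (π z) := fun e =>
          h.not_exchangeArc (Finset.mem_range.1 hi) hk
            ⟨z, own (gs (k + 1)), hne, hdz, (hown _ _).2 rfl, e⟩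
        have h2 := (hu z).le_card_s10 (π z \ {gs i} ∪ {gs (k + 1)})
        have h3 := Finset.card_union_le (π z \ {gs i}) {gs (k + 1)}
        have h4 : (π z \ {gs i}).card + 1 = (π z).card := by
          rw [Finset.sdiff_singleton_eq_erase]; exact Finset.card_erase_add_one hdz
        rw [hnr] at h1
        simp only [Finset.card_singleton] at h3
        omega
      have hex' : (u z (π z ∪ {gs (k + 1)}) ≤ (π z).card) →
          u z (partialBundle π own x gs z (k + 1)) = (partialBundle π own x gs z (k + 1)).card ∧
          (partialBundle π own x gs z (k + 1)).card = (partialBundle π own x gs z k).card := by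
        intro hsp
        rw [e]
        refine (hu z).exchange_of_span_sdiff (hnr z) hkS hbS hex
          ((hu z).sdiff_union_singleton_le_card (hnr z) hsp hD) ih.1
          Finset.subset_union_left ?_
        exact Finset.mem_union_left _ (Finset.mem_sdiff.2 ⟨hkS, hkimg⟩)
      by_cases hsp : u z (π z ∪ {gs (k + 1)}) ≤ (π z).card
      · rw [(hex' hsp).1, (hex' hsp).2]
        exact ⟨rfl, ih.2⟩
      · have hgain := ((hu z).2.2.2 (π z) _ hbS).2
        rw [hnr] at hgain
        have hzx : z ≠ x := by
          rintro rfl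
          refine h.notMem_Fgain (Nat.succ_pos k) hk ?_
          change u z (π z ∪ {gs (k + 1)}) = u z (π z) + 1
          rw [hnr]
          omega
        have hout : ∀ i < k, own (gs i) ≠ z := by
          intro i hi hiz
          have hiS : gs i ∈ π z := by rwa [hown]
          have h1 := hD (gs i) (Finset.mem_image_of_mem _ (Finset.mem_range.2 hi)) hiS
          have h2 := (hu z).le_add_card (π z \ {gs i} ∪ {gs (k + 1)}) {gs i}
          have e' : π z \ {gs i} ∪ {gs (k + 1)} ∪ {gs i} = π z ∪ {gs (k + 1)} := by
            ext; grind
          rw [e'] at h2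
          simp only [Finset.card_singleton] at h2
          omega
        have hX : partialBundle π own x gs z k = π z := by
          unfold partialBundle
          rw [Finset.filter_false_of_mem, Finset.image_empty, Finset.union_empty,
            Finset.sdiff_eq_self_of_disjoint]
          · rw [Finset.disjoint_right]
            intro d hd
            obtain ⟨i, hi, rfl⟩ := Finset.mem_image.1 hd
            rw [hown]
            exact hout i (Finset.mem_range.1 hi)
          · intro i hi
            rw [Finset.mem_range] at hi
            unfold pathRecipient
            split_ifs with hi0
            · exact hzx.symm
            · exact hout _ (by omega)
        have hc : (π z \ {gs k} ∪ {gs (k + 1)}).card = (π z).card := by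
          rw [Finset.card_union_of_disjoint (by simp [hbS]), Finset.sdiff_singleton_eq_erase,
            Finset.card_singleton]
          exact Finset.card_erase_add_one hkS
        rw [e, hX, hex, hc, hnr]
        simp [hzx]

end ShortestPath

/-- welfare effect of path augmentation.  Here `π` is a non-redundant
allocation whose bundles partition `G` (encoded by the owner function `own`:
`i ∈ π z ↔ own i = z`), `(gs 0, …, gs (t-1))` is a shortest path in the exchange
graph `G(π)` from `F_x(π)` to `π(y)`, and `π'` is obtained from `π` by the path
augmentation along this path (`gs 0` reassigned to `x`, each `gs k` for `k ≥ 1`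
reassigned to the owner of `gs (k-1)` under `π`, all other items keeping their
owner).  Then the total utilitarian welfare is preserved, while the welfare of the
agents other than `y` increases by exactly one. -/
theorem path_augmentation_welfare {I L : Type*} [Fintype I] [DecidableEq I]
    [Fintype L] [DecidableEq L] [Nonempty L]
    (u : L → Finset I → ℕ) (hu : ∀ z, IsMRF (u z))
    (π π' : L → Finset I) (own : I → L)
    (hown : ∀ (i : I) (z : L), i ∈ π z ↔ own i = z)
    (hπnr : ∀ z : L, u z (π z) = (π z).card)
    (x y : L) (hxy : x ≠ y)
    (t : ℕ) (gs : ℕ → I)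
    (hpath : IsTransferPath u π x y t gs)
    (hshortest : ∀ (t' : ℕ) (gs' : ℕ → I), IsTransferPath u π x y t' gs' → t ≤ t')
    (hπ'def : ∀ z : L, π' z =
      (π z \ (Finset.range t).image gs) ∪
      (((Finset.range t).filter fun k =>
          (if k = 0 then x else own (gs (k - 1))) = z).image gs)) :
    (∑ z, u z (π' z)) = (∑ z, u z (π z)) ∧
    (∑ z ∈ Finset.univ.erase y, u z (π' z)) =
      (∑ z ∈ Finset.univ.erase y, u z (π z)) + 1 := by
  have h : IsShortestTransferPath u π x y t gs := ⟨hpath, hshortest⟩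
  obtain ⟨s, rfl⟩ : ∃ s, t = s + 1 := ⟨t - 1, by have := hpath.1; omega⟩
  have hlast : gs s ∈ π y := by simpa using hpath.2.2.1
  have hother : ∀ z, z ≠ y → u z (π' z) = u z (π z) + if z = x then 1 else 0 := by
    intro z hz
    have hsz : gs s ∉ π z := by
      rw [hown] at hlast ⊢
      exact fun e => hz (e.symm.trans hlast)
    have e : π' z = partialBundle π own x gs z s := by
      rw [hπ'def]
      unfold partialBundle pathRecipient
      congr 1
      rw [Finset.range_add_one, Finset.image_insert]
      ext i
      grind
    have hb := partialBundle_independent hu hown hπnr h z s (Nat.lt_succ_self s)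
    rw [e, hb.1, hb.2, hπnr]
  have hy : u y (π' y) + 1 = u y (π y) := by
    have e : π' y = π y \ {gs s} := by
      rw [hπ'def, Finset.filter_false_of_mem, Finset.image_empty, Finset.union_empty,
        Finset.range_add_one, Finset.image_insert]
      · ext i
        have : ∀ j < s, gs j ∉ π y := fun j hj => h.notMem_target (by omega)
        simp only [Finset.mem_sdiff, Finset.mem_insert, Finset.mem_image, Finset.mem_range,
          Finset.mem_singleton]
        grind
      · intro i hi
        rw [Finset.mem_range] at hi
        split_ifs with hi0
        · exact hxy
        · rw [← hown]
          exact h.notMem_target (by omega)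
    rw [e, (hu y).eq_card_of_subset_s10 Finset.sdiff_subset (hπnr y), hπnr,
      Finset.sdiff_singleton_eq_erase, Finset.card_erase_add_one hlast]
  have hsum : (∑ z ∈ Finset.univ.erase y, u z (π' z)) =
      (∑ z ∈ Finset.univ.erase y, u z (π z)) + 1 := by
    rw [Finset.sum_congr rfl fun z hz => hother z (Finset.ne_of_mem_erase hz),
      Finset.sum_add_distrib, Finset.sum_ite_eq', if_pos (by simp [hxy])]
  refine ⟨?_, hsum⟩
  rw [← Finset.add_sum_erase _ _ (Finset.mem_univ y), hsum,
    ← Finset.add_sum_erase _ (fun z => u z (π z)) (Finset.mem_univ y), ← hy]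
  omega
end
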